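/- Under the asymptotic one-shot random-canary setup, the average squared canary–output inner product (1/k) Σ_{i=1}^k ⟨c_{di}, ρ_d⟩² converges in probability to 1 + σ² as d → ∞; in particular, Var[(1/k) Σ_{i=1}^k ⟨c_{di}, ρ_d⟩²] → 0 as d → ∞. -/

import Mathlib

open MeasureTheory ProbabilityTheory Real Filter
open scoped InnerProductSpace Topology ENNReal

/-- The standard Gaussian measure `N(0, I_d)` on `ℝ^d`, obtained by mapping the product
of `d` independent one-dimensional standard Gaussians onto `EuclideanSpace ℝ (Fin d)`. -/
noncomputable def stdGaussianE (d : ℕ) : Measure (EuclideanSpace ℝ (Fin d)) :=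
  Measure.map (⇑(EuclideanSpace.equiv (Fin d) ℝ).symm)
    (Measure.pi fun _ : Fin d => gaussianReal 0 1)

/-- The joint distribution of `k` i.i.d. canaries `c_1, …, c_k` drawn from the
(uniform) measure `μs` on the unit sphere, together with an independent standard
Gaussian vector `Z ∼ N(0, I_d)`.  A sample point is `ω = ((c_1, …, c_k), Z)`. -/
noncomputable def canaryP (d k : ℕ) (μs : Measure (EuclideanSpace ℝ (Fin d))) :
    Measure ((Fin k → EuclideanSpace ℝ (Fin d)) × EuclideanSpace ℝ (Fin d)) :=
  (Measure.pi fun _ : Fin k => μs).prod (stdGaussianE d)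

/-- The mechanism output `ρ = X + ∑_{i=1}^k c_i + σ Z`. -/
noncomputable def rhoF (d k : ℕ) (X : EuclideanSpace ℝ (Fin d)) (σ : ℝ)
    (ω : (Fin k → EuclideanSpace ℝ (Fin d)) × EuclideanSpace ℝ (Fin d)) :
    EuclideanSpace ℝ (Fin d) :=
  X + (∑ i, ω.1 i) + σ • ω.2

/-- The cosine statistic `g_i = ⟪c_i, ρ⟫ / ‖ρ‖` of the `i`-th canary. -/
noncomputable def cosStat (d k : ℕ) (X : EuclideanSpace ℝ (Fin d)) (σ : ℝ)
    (ω : (Fin k → EuclideanSpace ℝ (Fin d)) × EuclideanSpace ℝ (Fin d)) (i : Fin k) : ℝ :=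
  ⟪ω.1 i, rhoF d k X σ ω⟫_ℝ / ‖rhoF d k X σ ω‖

/-- The empirical mean `μ̂ = (1/k) ∑ᵢ g_i` of the canary cosines. -/
noncomputable def muHat (d k : ℕ) (X : EuclideanSpace ℝ (Fin d)) (σ : ℝ)
    (ω : (Fin k → EuclideanSpace ℝ (Fin d)) × EuclideanSpace ℝ (Fin d)) : ℝ :=
  (1 / k : ℝ) * ∑ i, cosStat d k X σ ω i

/-- The empirical variance `σ̂² = (1/k) ∑ᵢ (g_i - μ̂)²` of the canary cosines. -/
noncomputable def sigmaHatSq (d k : ℕ) (X : EuclideanSpace ℝ (Fin d)) (σ : ℝ)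
    (ω : (Fin k → EuclideanSpace ℝ (Fin d)) × EuclideanSpace ℝ (Fin d)) : ℝ :=
  (1 / k : ℝ) * ∑ i, (cosStat d k X σ ω i - muHat d k X σ ω) ^ 2


section GaussPart

lemma isub {α : Type*} [MeasurableSpace α] {μ : Measure α} {f g : α → ℝ} (hf : Integrable f μ)
    (hg : Integrable g μ) : Integrable (fun x => f x - g x) μ := hf.sub hg

lemma gm_deriv (v : ℝ) (p q : ℝ → ℝ) (hp : ∀ t, HasDerivAt p (q t) t) :
    deriv (fun t => p t * Real.exp (v * t ^ 2 / 2)) =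
      fun t => (q t + v * t * p t) * Real.exp (v * t ^ 2 / 2) := by
  funext t
  have h1 : HasDerivAt (fun t : ℝ => v * t ^ 2 / 2) (v * t) t := by
    have := ((hasDerivAt_pow 2 t).const_mul v).div_const 2
    convert! this using 1
    simp; ring
  have := (hp t).mul h1.exp
  rw [show (fun t => p t * Real.exp (v * t ^ 2 / 2)) = p * fun t => Real.exp (v * t ^ 2 / 2) from rfl,
    this.deriv]
  ring

lemma gm4 (v : NNReal) : ∫ x, x ^ 4 ∂(gaussianReal 0 v) = 3 * (v : ℝ) ^ 2 := by
  have h := iteratedDeriv_mgf_zero (X := id) (μ := gaussianReal 0 v)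
    (by simp [integrableExpSet_id_gaussianReal]) 4
  have e : ∫ x, x ^ 4 ∂(gaussianReal 0 v) = (gaussianReal 0 v)[id ^ 4] := by simp
  rw [e, ← h, mgf_id_gaussianReal]
  have h0 : (fun t : ℝ => Real.exp (0 * t + v * t ^ 2 / 2)) =
      fun t => (fun _ => (1:ℝ)) t * Real.exp (v * t ^ 2 / 2) := by funext t; simp
  rw [h0, iteratedDeriv_succ', iteratedDeriv_succ', iteratedDeriv_succ', iteratedDeriv_succ',
    iteratedDeriv_zero]
  rw [gm_deriv v _ (fun _ => 0) (fun t => hasDerivAt_const _ _)]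
  rw [gm_deriv v _ (fun _ => (v:ℝ)) (fun t => by
    simpa using (hasDerivAt_id t).const_mul (v:ℝ))]
  rw [gm_deriv v _ (fun t => 2 * (v:ℝ)^2 * t) (fun t => by
    have := ((hasDerivAt_pow 2 t).const_mul ((v:ℝ)^2)).const_add (v:ℝ)
    convert! this using 1
    · funext t; simp; ring
    · simp; ring)]
  rw [gm_deriv v _ (fun t => 3 * (v:ℝ)^2 + 3 * (v:ℝ)^3 * t^2) (fun t => by
    have := ((hasDerivAt_pow 3 t).const_mul ((v:ℝ)^3)).add ((hasDerivAt_id t).const_mul (3 * (v:ℝ)^2))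
    convert! this using 1
    · funext t; simp; ring
    · simp; ring)]
  simp

variable {d : ℕ}

lemma stdGaussianE_eq (d : ℕ) : stdGaussianE d = stdGaussian (EuclideanSpace ℝ (Fin d)) := by
  rw [← map_pi_eq_stdGaussian]; rfl

instance : IsProbabilityMeasure (stdGaussianE d) := by
  rw [stdGaussianE_eq]; infer_instance

lemma map_inner_g (u : EuclideanSpace ℝ (Fin d)) :
    (stdGaussianE d).map (fun z => ⟪u, z⟫_ℝ) = gaussianReal 0 (‖u‖ ^ 2).toNNReal := by
  have h := IsGaussian.map_eq_gaussianReal (μ := stdGaussian (EuclideanSpace ℝ (Fin d))) (innerSL ℝ u)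
  rw [integral_strongDual_stdGaussian, variance_dual_stdGaussian, innerSL_apply_norm] at h
  rw [stdGaussianE_eq]
  exact h

lemma memLp_g (u : EuclideanSpace ℝ (Fin d)) (p : ℝ≥0∞) (hp : p ≠ ⊤) :
    MemLp (fun z => ⟪u, z⟫_ℝ) p (stdGaussianE d) := by
  rw [stdGaussianE_eq]
  exact IsGaussian.memLp_dual _ (innerSL ℝ u) p hp

lemma g2 (u : EuclideanSpace ℝ (Fin d)) : ∫ z, ⟪u, z⟫_ℝ ^ 2 ∂(stdGaussianE d) = ‖u‖ ^ 2 := by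
  have := integral_map (μ := stdGaussianE d) (φ := fun z => ⟪u, z⟫_ℝ) (by fun_prop)
    (f := fun x : ℝ => x ^ 2) (by fun_prop)
  rw [← this, map_inner_g]
  have h := variance_id_gaussianReal (μ := 0) (v := (‖u‖ ^ 2).toNNReal)
  rw [variance_eq_integral (by fun_prop)] at h
  simpa using h

lemma g4 (u : EuclideanSpace ℝ (Fin d)) : ∫ z, ⟪u, z⟫_ℝ ^ 4 ∂(stdGaussianE d) = 3 * ‖u‖ ^ 4 := by
  have := integral_map (μ := stdGaussianE d) (φ := fun z => ⟪u, z⟫_ℝ) (by fun_prop)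
    (f := fun x : ℝ => x ^ 4) (by fun_prop)
  rw [← this, map_inner_g, gm4]
  simp; ring

lemma ig2 (u : EuclideanSpace ℝ (Fin d)) :
    Integrable (fun z => ⟪u, z⟫_ℝ ^ 2) (stdGaussianE d) := by
  exact (memLp_g u 2 (by simp)).integrable_sq

lemma ig4 (u : EuclideanSpace ℝ (Fin d)) :
    Integrable (fun z => ⟪u, z⟫_ℝ ^ 4) (stdGaussianE d) := by
  have := (memLp_g u 4 (by simp)).integrable_norm_pow (p := 4) (by simp)
  refine this.congr (ae_of_all _ fun z => ?_)
  simp [Even.pow_abs (show Even 4 by decide)]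

lemma g22_aux (u v z : EuclideanSpace ℝ (Fin d)) : ⟪u, z⟫_ℝ ^ 2 * ⟪v, z⟫_ℝ ^ 2 =
    (1 / 12) * (⟪u + v, z⟫_ℝ ^ 4 + ⟪u - v, z⟫_ℝ ^ 4 - 2 * ⟪u, z⟫_ℝ ^ 4 - 2 * ⟪v, z⟫_ℝ ^ 4) := by
  rw [inner_add_left, inner_sub_left]; ring

lemma ig22 (u v : EuclideanSpace ℝ (Fin d)) :
    Integrable (fun z => ⟪u, z⟫_ℝ ^ 2 * ⟪v, z⟫_ℝ ^ 2) (stdGaussianE d) := by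
  simp_rw [g22_aux]
  exact ((((ig4 _).add (ig4 _)).sub ((ig4 _).const_mul 2)).sub ((ig4 _).const_mul 2)).const_mul _

lemma g22 (u v : EuclideanSpace ℝ (Fin d)) :
    ∫ z, ⟪u, z⟫_ℝ ^ 2 * ⟪v, z⟫_ℝ ^ 2 ∂(stdGaussianE d) =
      ‖u‖ ^ 2 * ‖v‖ ^ 2 + 2 * ⟪u, v⟫_ℝ ^ 2 := by
  simp_rw [g22_aux]
  rw [integral_const_mul, integral_sub (isub ((ig4 _).fun_add (ig4 _)) ((ig4 _).const_mul 2))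
    ((ig4 _).const_mul 2), integral_sub ((ig4 _).fun_add (ig4 _)) ((ig4 _).const_mul 2),
    integral_add (ig4 _) (ig4 _), integral_const_mul, integral_const_mul, g4, g4, g4, g4]
  have h1 := norm_add_sq_real u v
  have h2 := norm_sub_sq_real u v
  rw [show ‖u+v‖^4 = (‖u+v‖^2)^2 by ring, show ‖u-v‖^4 = (‖u-v‖^2)^2 by ring, h1, h2]
  ring

/-- mean square deviation of the empirical second moment -/
lemma g_dev {k : ℕ} (hk : 0 < k) (c : Fin k → EuclideanSpace ℝ (Fin d)) (hc : ∀ i, ‖c i‖ = 1) :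
    Integrable (fun z => ((1 / k : ℝ) * ∑ i, ⟪c i, z⟫_ℝ ^ 2 - 1) ^ 2) (stdGaussianE d) ∧
    ∫ z, ((1 / k : ℝ) * ∑ i, ⟪c i, z⟫_ℝ ^ 2 - 1) ^ 2 ∂(stdGaussianE d) =
      (2 / (k:ℝ) ^ 2) * ∑ i, ∑ j, ⟪c i, c j⟫_ℝ ^ 2 := by
  have hk' : (k : ℝ) ≠ 0 := by positivity
  have e : ∀ z, ((1 / k : ℝ) * ∑ i, ⟪c i, z⟫_ℝ ^ 2 - 1) ^ 2 =
      (1 / (k:ℝ) ^ 2) * (∑ i, ∑ j, ⟪c i, z⟫_ℝ ^ 2 * ⟪c j, z⟫_ℝ ^ 2)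
        - (2 / k) * (∑ i, ⟪c i, z⟫_ℝ ^ 2) + 1 := by
    intro z
    rw [← Finset.sum_mul_sum]
    field_simp
    ring
  have i1 : Integrable (fun z => (1 / (k:ℝ) ^ 2) * (∑ i, ∑ j, ⟪c i, z⟫_ℝ ^ 2 * ⟪c j, z⟫_ℝ ^ 2))
      (stdGaussianE d) :=
    (integrable_finsetSum _ fun i _ => integrable_finsetSum _ fun j _ => ig22 _ _).const_mul _
  have i2 : Integrable (fun z => (2 / (k:ℝ)) * (∑ i, ⟪c i, z⟫_ℝ ^ 2)) (stdGaussianE d) :=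
    (integrable_finsetSum _ fun i _ => ig2 _).const_mul _
  simp_rw [e]
  refine ⟨(i1.sub i2).add (integrable_const _), ?_⟩
  rw [integral_add (isub i1 i2) (integrable_const _), integral_sub i1 i2, integral_const_mul,
    integral_const_mul, integral_finsetSum _ (fun i _ => ig2 _),
    integral_finsetSum _ (fun i _ => integrable_finsetSum _ fun j _ => ig22 _ _)]
  simp_rw [integral_finsetSum Finset.univ (fun j _ => ig22 (c _) (c j)), g22, g2, hc,
    Finset.sum_add_distrib, ← Finset.mul_sum]
  simp
  field_simp
  ring

end GaussPart

section InnerPart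

lemma m_sq {k : ℕ} (hk : 0 < k) (f : Fin k → ℝ) :
    ((1 / k : ℝ) * ∑ i, f i) ^ 2 ≤ (1 / k : ℝ) * ∑ i, f i ^ 2 := by
  have hk' : (0:ℝ) < k := by positivity
  have h := sq_sum_le_card_mul_sum_sq (s := Finset.univ) (f := f)
  simp only [Finset.card_univ, Fintype.card_fin] at h
  rw [mul_pow, show (1 / k : ℝ) * ∑ i, f i ^ 2 = (1 / k : ℝ) ^ 2 * (k * ∑ i, f i ^ 2) by field_simp]
  gcongr

lemma five_sq (a b c d e : ℝ) :
    (a + b + c + d + e) ^ 2 ≤ 5 * (a ^ 2 + b ^ 2 + c ^ 2 + d ^ 2 + e ^ 2) := by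
  nlinarith [sq_nonneg (a - b), sq_nonneg (a - c), sq_nonneg (a - d), sq_nonneg (a - e),
    sq_nonneg (b - c), sq_nonneg (b - d), sq_nonneg (b - e), sq_nonneg (c - d), sq_nonneg (c - e),
    sq_nonneg (d - e)]

/-- bound on the conditional mean square error given the canaries -/
noncomputable def condB {d k : ℕ} (σ : ℝ) (X : EuclideanSpace ℝ (Fin d))
    (c : Fin k → EuclideanSpace ℝ (Fin d)) : ℝ :=
  5 * (σ ^ 4 * ((2 / (k:ℝ) ^ 2) * ∑ i, ∑ j, ⟪c i, c j⟫_ℝ ^ 2)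
    + (1 / k : ℝ) * ∑ i, ⟪c i, X + ∑ j, c j - c i⟫_ℝ ^ 4
    + 4 * ((1 / k : ℝ) * ∑ i, ⟪c i, X + ∑ j, c j - c i⟫_ℝ ^ 2)
    + 4 * σ ^ 2 * ((1 / (k:ℝ) ^ 2) * ‖∑ j, c j‖ ^ 2)
    + 4 * σ ^ 2 * ((1 / k : ℝ) * ∑ i, ⟪c i, X + ∑ j, c j - c i⟫_ℝ ^ 2))

lemma inner_bound {d k : ℕ} (hk : 0 < k) (σ : ℝ) (X : EuclideanSpace ℝ (Fin d))
    (c : Fin k → EuclideanSpace ℝ (Fin d)) (hc : ∀ i, ‖c i‖ = 1) :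
    ∫⁻ z, ENNReal.ofReal (((1 / k : ℝ) * ∑ i, ⟪c i, X + (∑ j, c j) + σ • z⟫_ℝ ^ 2
      - (1 + σ ^ 2)) ^ 2) ∂(stdGaussianE d) ≤ ENNReal.ofReal (condB σ X c) := by
  have hk' : (0 : ℝ) < k := by positivity
  set a : Fin k → ℝ := fun i => ⟪c i, X + ∑ j, c j - c i⟫_ℝ with ha
  have hexp : ∀ i z, ⟪c i, X + (∑ j, c j) + σ • z⟫_ℝ = 1 + a i + σ * ⟪c i, z⟫_ℝ := by
    intro i z
    rw [inner_add_right, real_inner_smul_right]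
    simp only [ha, inner_sub_right, real_inner_self_eq_norm_sq, hc]
    ring
  let F : EuclideanSpace ℝ (Fin d) → ℝ := fun z =>
    5 * (σ ^ 4 * ((1 / k : ℝ) * ∑ i, ⟪c i, z⟫_ℝ ^ 2 - 1) ^ 2
    + (1 / k : ℝ) * ∑ i, a i ^ 4
    + 4 * ((1 / k : ℝ) * ∑ i, a i ^ 2)
    + 4 * σ ^ 2 * ((1 / (k:ℝ) ^ 2) * ⟪∑ j, c j, z⟫_ℝ ^ 2)
    + 4 * σ ^ 2 * ((1 / k : ℝ) * ∑ i, a i ^ 2 * ⟪c i, z⟫_ℝ ^ 2))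
  have hpt : ∀ z, ((1 / k : ℝ) * ∑ i, ⟪c i, X + (∑ j, c j) + σ • z⟫_ℝ ^ 2
      - (1 + σ ^ 2)) ^ 2 ≤ F z := by
    intro z
    have e : (1 / k : ℝ) * ∑ i, ⟪c i, X + (∑ j, c j) + σ • z⟫_ℝ ^ 2 - (1 + σ ^ 2)
      = σ ^ 2 * ((1 / k : ℝ) * ∑ i, ⟪c i, z⟫_ℝ ^ 2 - 1) + (1 / k : ℝ) * ∑ i, a i ^ 2
        + 2 * ((1 / k : ℝ) * ∑ i, a i) + 2 * σ * ((1 / k : ℝ) * ⟪∑ j, c j, z⟫_ℝ)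
        + 2 * σ * ((1 / k : ℝ) * ∑ i, a i * ⟪c i, z⟫_ℝ) := by
      have e1 : ∑ i, ⟪c i, X + (∑ j, c j) + σ • z⟫_ℝ ^ 2 = k + σ ^ 2 * ∑ i, ⟪c i, z⟫_ℝ ^ 2
          + ∑ i, a i ^ 2 + 2 * ∑ i, a i + 2 * σ * ∑ i, ⟪c i, z⟫_ℝ
          + 2 * σ * ∑ i, a i * ⟪c i, z⟫_ℝ := by
        have : (k : ℝ) = ∑ i : Fin k, (1:ℝ) := by simp
        rw [this]
        simp only [Finset.mul_sum, ← Finset.sum_add_distrib]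
        refine Finset.sum_congr rfl fun i _ => ?_
        rw [hexp]; ring
      rw [e1, sum_inner]
      field_simp
      ring
    rw [e]
    refine (five_sq _ _ _ _ _).trans ?_
    have h1 := m_sq hk (fun i => a i ^ 2)
    have h2 := m_sq hk a
    have h3 := m_sq hk (fun i => a i * ⟪c i, z⟫_ℝ)
    have h3' : σ ^ 2 * ((1 / k : ℝ) * ∑ i, a i * ⟪c i, z⟫_ℝ) ^ 2 ≤
       σ ^ 2 * ((1 / k : ℝ) * ∑ i, (a i * ⟪c i, z⟫_ℝ) ^ 2) := by gcongr
    simp only [← pow_mul, mul_pow _ _ 2] at h1 h2 h3 h3'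
    simp only [F, mul_pow, ← pow_mul] at *
    norm_num at *
    linarith
  obtain ⟨i0, v0⟩ := g_dev (d := d) hk c hc
  have i1 : Integrable (fun z => σ ^ 4 * ((1 / k : ℝ) * ∑ i, ⟪c i, z⟫_ℝ ^ 2 - 1) ^ 2)
    (stdGaussianE d) := i0.const_mul _
  have i2 : Integrable (fun _ : EuclideanSpace ℝ (Fin d) => (1 / k : ℝ) * ∑ i, a i ^ 4)
    (stdGaussianE d) := integrable_const _
  have i3 : Integrable (fun _ : EuclideanSpace ℝ (Fin d) => 4 * ((1 / k : ℝ) * ∑ i, a i ^ 2))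
    (stdGaussianE d) := integrable_const _
  have i4 : Integrable (fun z => 4 * σ ^ 2 * ((1 / (k:ℝ) ^ 2) * ⟪∑ j, c j, z⟫_ℝ ^ 2))
    (stdGaussianE d) := ((ig2 _).const_mul _).const_mul _
  have i5' : ∀ i ∈ Finset.univ, Integrable (fun z => a i ^ 2 * ⟪c i, z⟫_ℝ ^ 2)
    (stdGaussianE d) := fun i _ => (ig2 _).const_mul _
  have i5 : Integrable (fun z => 4 * σ ^ 2 * ((1 / k : ℝ) * ∑ i, a i ^ 2 * ⟪c i, z⟫_ℝ ^ 2))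
    (stdGaussianE d) := ((integrable_finsetSum _ i5').const_mul _).const_mul _
  have i12 := i1.fun_add i2
  have i123 := i12.fun_add i3
  have i1234 := i123.fun_add i4
  have iF : Integrable F (stdGaussianE d) := (i1234.fun_add i5).const_mul 5
  have hF : ∫ z, F z ∂(stdGaussianE d) = condB σ X c := by
    simp only [F, condB]
    rw [integral_const_mul, integral_add i1234 i5, integral_add i123 i4, integral_add i12 i3,
      integral_add i1 i2]
    simp_rw [integral_const_mul]
    rw [v0, integral_finsetSum _ i5', g2]
    simp_rw [integral_const_mul, g2, hc]
    simp [ha]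
  rw [← hF, ofReal_integral_eq_lintegral_ofReal iF
    (ae_of_all _ fun z => (sq_nonneg _).trans (hpt z))]
  exact lintegral_mono fun z => ENNReal.ofReal_le_ofReal (hpt z)

end InnerPart

section SpherePart

open scoped RealInnerProductSpace

variable {d : ℕ} {μ : Measure (EuclideanSpace ℝ (Fin d))}

lemma ae_norm [IsProbabilityMeasure μ]
    (hs : μ (Metric.sphere (0 : EuclideanSpace ℝ (Fin d)) 1) = 1) : ∀ᵐ c ∂μ, ‖c‖ = 1 := by
  have := (prob_compl_eq_zero_iff (μ := μ) (s := Metric.sphere (0 : EuclideanSpace ℝ (Fin d)) 1)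
    Metric.isClosed_sphere.measurableSet).2 hs
  rw [ae_iff]
  convert! this using 2
  ext x; simp

lemma ae_pi_norm [IsProbabilityMeasure μ] (hn : ∀ᵐ c ∂μ, ‖c‖ = 1) (n : ℕ) :
    ∀ᵐ c ∂(Measure.pi fun _ : Fin n => μ), ∀ i, ‖c i‖ = 1 := by
  rw [ae_all_iff]
  intro i
  exact (Measure.quasiMeasurePreserving_eval (fun _ : Fin n => μ) i).ae hn

lemma icont [IsProbabilityMeasure μ] (hn : ∀ᵐ c ∂μ, ‖c‖ = 1)
    {f : EuclideanSpace ℝ (Fin d) → ℝ} (hf : Continuous f) : Integrable f μ := by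
  obtain ⟨C, hC⟩ := (isCompact_closedBall (0 : EuclideanSpace ℝ (Fin d)) 1).exists_bound_of_continuousOn
    hf.continuousOn
  refine Integrable.of_bound hf.aestronglyMeasurable C ?_
  filter_upwards [hn] with c hc
  exact hC c (by simp [hc])

lemma icont_pi [IsProbabilityMeasure μ] (hn : ∀ᵐ c ∂μ, ‖c‖ = 1) {n : ℕ}
    {f : (Fin n → EuclideanSpace ℝ (Fin d)) → ℝ} (hf : Continuous f) :
    Integrable f (Measure.pi fun _ : Fin n => μ) := by
  obtain ⟨C, hC⟩ := (isCompact_closedBall (0 : Fin n → EuclideanSpace ℝ (Fin d)) 1).exists_bound_of_continuousOn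
    hf.continuousOn
  refine Integrable.of_bound hf.aestronglyMeasurable C ?_
  filter_upwards [ae_pi_norm hn n] with c hc
  refine hC c ?_
  rw [mem_closedBall_zero_iff, pi_norm_le_iff_of_nonneg zero_le_one]
  intro i; rw [hc i]

lemma pi_split [IsProbabilityMeasure μ] (hn : ∀ᵐ c ∂μ, ‖c‖ = 1) {n : ℕ} (i : Fin (n + 1))
    {f : (Fin (n + 1) → EuclideanSpace ℝ (Fin d)) → ℝ} (hf : Continuous f) :
    ∫ c, f c ∂(Measure.pi fun _ : Fin (n + 1) => μ) =
      ∫ y, ∫ c, f (i.insertNth c y) ∂μ ∂(Measure.pi fun _ : Fin n => μ) := by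
  have hp := (measurePreserving_piFinSuccAbove (fun _ : Fin (n + 1) => μ) i).symm
  rw [← hp.integral_comp']
  have hi := (hp.integrable_comp_emb (MeasurableEquiv.measurableEmbedding _)).2 (icont_pi hn hf)
  exact integral_prod_symm _ hi

/-- invariance of marginals -/
lemma inv_int (hinv : ∀ O : EuclideanSpace ℝ (Fin d) ≃ₗᵢ[ℝ] EuclideanSpace ℝ (Fin d), μ.map O = μ)
    (m : ℕ) (u v : EuclideanSpace ℝ (Fin d)) (h : ‖u‖ = ‖v‖) :
    ∫ c, ⟪c, u⟫_ℝ ^ m ∂μ = ∫ c, ⟪c, v⟫_ℝ ^ m ∂μ := by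
  set O := (ℝ ∙ (u - v))ᗮ.reflection
  have hO : O u = v := Submodule.reflection_sub h
  have : ∫ c, ⟪c, v⟫_ℝ ^ m ∂(μ.map O) = ∫ c, ⟪O c, v⟫_ℝ ^ m ∂μ :=
    integral_map O.continuous.aemeasurable
      (Continuous.aestronglyMeasurable (by fun_prop))
  rw [hinv O] at this
  rw [this, ← hO]
  simp_rw [LinearIsometryEquiv.inner_map_map]

lemma inv_fst (hinv : ∀ O : EuclideanSpace ℝ (Fin d) ≃ₗᵢ[ℝ] EuclideanSpace ℝ (Fin d), μ.map O = μ)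
    (u : EuclideanSpace ℝ (Fin d)) : ∫ c, ⟪c, u⟫_ℝ ∂μ = 0 := by
  have := inv_int hinv 1 u (-u) (by simp)
  simp only [pow_one, inner_neg_right, integral_neg] at this
  linarith

variable [IsProbabilityMeasure μ] (hn : ∀ᵐ c ∂μ, ‖c‖ = 1)
  (hinv : ∀ O : EuclideanSpace ℝ (Fin d) ≃ₗᵢ[ℝ] EuclideanSpace ℝ (Fin d), μ.map O = μ)

lemma norm_sq_coord (c : EuclideanSpace ℝ (Fin d)) :
    ‖c‖ ^ 2 = ∑ i, ⟪c, EuclideanSpace.single i (1:ℝ)⟫_ℝ ^ 2 := by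
  rw [EuclideanSpace.real_norm_sq_eq]
  simp [EuclideanSpace.inner_single_right]

include hinv in
lemma hom_int (m : ℕ) (i : Fin d) (y : EuclideanSpace ℝ (Fin d)) :
    ∫ c, ⟪c, y⟫_ℝ ^ m ∂μ = ‖y‖ ^ m * ∫ c, ⟪c, EuclideanSpace.single i (1:ℝ)⟫_ℝ ^ m ∂μ := by
  rw [inv_int hinv m y (‖y‖ • EuclideanSpace.single i (1:ℝ)) (by simp [norm_smul])]
  simp_rw [real_inner_smul_right, mul_pow, integral_const_mul]

include hn hinv in
lemma s2 (hd : 1 ≤ d) (y : EuclideanSpace ℝ (Fin d)) :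
    ∫ c, ⟪c, y⟫_ℝ ^ 2 ∂μ = ‖y‖ ^ 2 / d := by
  let i0 : Fin d := ⟨0, hd⟩
  have hd' : (0:ℝ) < d := by positivity
  have h : ∫ c, ‖c‖ ^ 2 ∂μ = 1 := by
    rw [integral_congr_ae (g := fun _ => (1:ℝ)) (by filter_upwards [hn] with c hc; simp [hc])]
    simp
  simp_rw [norm_sq_coord] at h
  rw [integral_finsetSum _ (fun i _ => icont hn (by fun_prop))] at h
  rw [Finset.sum_congr rfl (fun i _ => hom_int hinv 2 i0 (EuclideanSpace.single i (1:ℝ)))] at h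
  rw [hom_int hinv 2 i0 y]
  simp at h
  field_simp
  rw [mul_assoc, mul_comm _ (d:ℝ), h, mul_one]

include hn hinv in
lemma s4 (hd : 1 ≤ d) (y : EuclideanSpace ℝ (Fin d)) :
    ∫ c, ⟪c, y⟫_ℝ ^ 4 ∂μ ≤ 3 * ‖y‖ ^ 4 / d ^ 2 := by
  let i0 : Fin d := ⟨0, hd⟩
  have hd' : (0:ℝ) < d := by positivity
  set e : Fin d → EuclideanSpace ℝ (Fin d) := fun i => EuclideanSpace.single i (1:ℝ) with he
  set m4 := ∫ c, ⟪c, e i0⟫_ℝ ^ 4 ∂μ with hm4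
  have hm0 : 0 ≤ m4 := integral_nonneg fun c => by positivity
  have hm : ∀ y, ∫ c, ⟪c, y⟫_ℝ ^ 4 ∂μ = ‖y‖ ^ 4 * m4 := fun y => hom_int hinv 4 i0 y
  have hne : ∀ i, ‖e i‖ = 1 := fun i => by simp [he]
  have h : ∫ c, (‖c‖ ^ 2) ^ 2 ∂μ = 1 := by
    rw [integral_congr_ae (g := fun _ => (1:ℝ)) (by filter_upwards [hn] with c hc; simp [hc])]
    simp
  simp_rw [norm_sq_coord, sq (∑ _, _), Finset.sum_mul_sum] at h
  rw [integral_finsetSum _ (fun i _ => icont hn (by fun_prop))] at h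
  simp_rw [fun i => integral_finsetSum (μ := μ) Finset.univ
    (f := fun j c => ⟪c, EuclideanSpace.single i (1:ℝ)⟫_ℝ ^ 2 * ⟪c, EuclideanSpace.single j (1:ℝ)⟫_ℝ ^ 2)
    (fun j _ => icont hn (by fun_prop))] at h
  have hM : ∀ i j, m4 / 3 ≤ ∫ c, ⟪c, e i⟫_ℝ ^ 2 * ⟪c, e j⟫_ℝ ^ 2 ∂μ := by
    intro i j
    by_cases hij : i = j
    · subst hij
      have : ∀ c, ⟪c, e i⟫_ℝ ^ 2 * ⟪c, e i⟫_ℝ ^ 2 = ⟪c, e i⟫_ℝ ^ 4 := fun c => by ring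
      simp_rw [this, hm, hne]
      linarith
    · have e1 : ∀ c, ⟪c, e i⟫_ℝ ^ 2 * ⟪c, e j⟫_ℝ ^ 2 = (1 / 12) * (⟪c, e i + e j⟫_ℝ ^ 4 +
          ⟪c, e i - e j⟫_ℝ ^ 4 - 2 * ⟪c, e i⟫_ℝ ^ 4 - 2 * ⟪c, e j⟫_ℝ ^ 4) := by
        intro c; rw [inner_add_right, inner_sub_right]; ring
      have ho : ⟪e i, e j⟫_ℝ = 0 := by
        simp [he, EuclideanSpace.inner_single_left, hij]
      have n1 : ‖e i + e j‖ ^ 4 = 4 := by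
        rw [show ‖e i + e j‖ ^ 4 = (‖e i + e j‖ ^ 2) ^ 2 by ring, norm_add_sq_real, ho, hne, hne]
        norm_num
      have n2 : ‖e i - e j‖ ^ 4 = 4 := by
        rw [show ‖e i - e j‖ ^ 4 = (‖e i - e j‖ ^ 2) ^ 2 by ring, norm_sub_sq_real, ho, hne, hne]
        norm_num
      have ii : ∀ y, Integrable (fun c => ⟪c, y⟫_ℝ ^ 4) μ := fun y => icont hn (by fun_prop)
      simp_rw [e1]
      rw [integral_const_mul, integral_sub (isub ((ii _).fun_add (ii _)) ((ii _).const_mul 2))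
        ((ii _).const_mul 2), integral_sub ((ii _).fun_add (ii _)) ((ii _).const_mul 2),
        integral_add (ii _) (ii _), integral_const_mul, integral_const_mul, hm, hm, hm, hm,
        n1, n2, hne, hne]
      linarith
  have hsum : ∑ i : Fin d, ∑ j : Fin d, m4 / 3 ≤ 1 := by
    rw [← h]
    exact Finset.sum_le_sum fun i _ => Finset.sum_le_sum fun j _ => hM i j
  simp at hsum
  rw [hm, le_div_iff₀ (by positivity)]
  have : m4 * (d:ℝ) ^ 2 ≤ 3 := by nlinarith
  calc ‖y‖ ^ 4 * m4 * (d:ℝ) ^ 2 = ‖y‖ ^ 4 * (m4 * (d:ℝ) ^ 2) := by ring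
    _ ≤ ‖y‖ ^ 4 * 3 := by gcongr
    _ = _ := by ring

include hn hinv in
lemma norm4 (n : ℕ) (X : EuclideanSpace ℝ (Fin d)) (a : ℝ) (ha : 0 ≤ a) :
    ∫ c, (‖X + ∑ j, c j‖ ^ 2 + a) ^ 2 ∂(Measure.pi fun _ : Fin n => μ) ≤
      (‖X‖ ^ 2 + 3 * n + a) ^ 2 := by
  induction n generalizing a with
  | zero => simp
  | succ n ih =>
    rw [pi_split hn 0 (by fun_prop)]
    have key : ∀ w : EuclideanSpace ℝ (Fin d),
        ∫ c, (‖w + c‖ ^ 2 + a) ^ 2 ∂μ ≤ (‖w‖ ^ 2 + (a + 3)) ^ 2 := by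
      intro w
      have e : ∀ᵐ c ∂μ, (‖w + c‖ ^ 2 + a) ^ 2 ≤
          (‖w‖ ^ 2 + 1 + a) ^ 2 + 4 * ‖w‖ ^ 2 + 4 * (‖w‖ ^ 2 + 1 + a) * ⟪c, w⟫_ℝ := by
        filter_upwards [hn] with c hc
        rw [norm_add_sq_real, hc, real_inner_comm]
        have := abs_real_inner_le_norm c w
        rw [hc, one_mul] at this
        have h2 : ⟪c, w⟫_ℝ ^ 2 ≤ ‖w‖ ^ 2 := by
          rw [← sq_abs]; gcongr
        nlinarith
      have i1 : Integrable (fun c => 4 * (‖w‖ ^ 2 + 1 + a) * ⟪c, w⟫_ℝ) μ :=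
        icont hn (by fun_prop)
      refine (integral_mono_ae (icont hn (by fun_prop)) (icont hn (by fun_prop)) e).trans ?_
      rw [integral_add (integrable_const _) i1, integral_const_mul, inv_fst hinv]
      simp
      nlinarith [sq_nonneg ‖w‖]
    have e : ∀ y : Fin n → EuclideanSpace ℝ (Fin d),
      ∫ c, (‖X + ∑ j, (Fin.insertNth (α := fun _ => EuclideanSpace ℝ (Fin d)) 0 c y) j‖ ^ 2 + a) ^ 2 ∂μ ≤
        (‖X + ∑ j, y j‖ ^ 2 + (a + 3)) ^ 2 := by
      intro y
      refine le_trans (le_of_eq ?_) (key _)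
      congr 1; funext c
      rw [Fin.sum_univ_succAbove _ 0]
      simp only [Fin.insertNth_apply_same, Fin.insertNth_apply_succAbove]
      rw [add_assoc X, add_comm c]
    refine (integral_mono_of_nonneg (ae_of_all _ fun y => integral_nonneg fun c => by positivity)
      (icont_pi hn (by fun_prop)) (ae_of_all _ e)).trans ?_
    refine (ih (a + 3) (by linarith)).trans (le_of_eq ?_)
    push_cast; ring

include hn in
lemma jens (n : ℕ) {f : (Fin n → EuclideanSpace ℝ (Fin d)) → ℝ} (hf : Continuous f) :
    (∫ c, f c ∂(Measure.pi fun _ : Fin n => μ)) ^ 2 ≤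
      ∫ c, f c ^ 2 ∂(Measure.pi fun _ : Fin n => μ) := by
  set P := Measure.pi fun _ : Fin n => μ
  set m := ∫ c, f c ∂P
  have h : 0 ≤ ∫ c, (f c - m) ^ 2 ∂P := integral_nonneg fun c => by positivity
  have e : ∀ c, (f c - m) ^ 2 = f c ^ 2 - 2 * m * f c + m ^ 2 := fun c => by ring
  have j1 : Integrable (fun c => f c ^ 2) P := icont_pi hn (by fun_prop)
  have j2 : Integrable (fun c => 2 * m * f c) P := icont_pi hn (by fun_prop)
  simp_rw [e] at h
  rw [integral_add (isub j1 j2) (integrable_const _), integral_sub j1 j2, integral_const_mul] at h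
  simp at h
  change 0 ≤ _ - 2 * m * m + m ^ 2 at h
  linarith

include hn hinv in
lemma norm2 (n : ℕ) : ∫ c, ‖∑ j, c j‖ ^ 2 ∂(Measure.pi fun _ : Fin n => μ) ≤ 3 * n := by
  have h1 := norm4 hn hinv n 0 0 le_rfl
  have h2 := jens (μ := μ) hn n (f := fun c => ‖∑ j, c j‖ ^ 2) (by fun_prop)
  simp only [zero_add, add_zero, norm_zero, ne_eq, OfNat.ofNat_ne_zero, not_false_eq_true, zero_pow] at h1
  exact le_of_sq_le_sq (h2.trans h1) (by positivity)

include hn hinv in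
lemma a4 (hd : 1 ≤ d) {n : ℕ} (i : Fin n) (X : EuclideanSpace ℝ (Fin d)) :
    ∫ c, ⟪c i, X + ∑ j, c j - c i⟫_ℝ ^ 4 ∂(Measure.pi fun _ : Fin n => μ) ≤
      3 * ((‖X‖ ^ 2 + 3 * n) / d) ^ 2 := by
  obtain _ | n := n
  · exact i.elim0
  rw [pi_split hn i (by fun_prop)]
  have e : ∀ y : Fin n → EuclideanSpace ℝ (Fin d),
      ∫ c, ⟪(i.insertNth (α := fun _ => EuclideanSpace ℝ (Fin d)) c y) i,
        X + ∑ j, (i.insertNth (α := fun _ => EuclideanSpace ℝ (Fin d)) c y) j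
          - (i.insertNth (α := fun _ => EuclideanSpace ℝ (Fin d)) c y) i⟫_ℝ ^ 4 ∂μ ≤
        3 / d ^ 2 * (‖X + ∑ j, y j‖ ^ 2 + 0) ^ 2 := by
    intro y
    have := s4 hn hinv hd (X + ∑ j, y j)
    refine le_trans (le_of_eq ?_) (this.trans (le_of_eq (by ring)))
    congr 1; funext c
    rw [Fin.sum_univ_succAbove _ i]
    simp only [Fin.insertNth_apply_same, Fin.insertNth_apply_succAbove]
    congr 2; abel
  refine (integral_mono_of_nonneg (ae_of_all _ fun y => integral_nonneg fun c => by positivity)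
      (icont_pi hn (by fun_prop)) (ae_of_all _ e)).trans ?_
  rw [integral_const_mul]
  have h4 := norm4 hn hinv n X 0 le_rfl
  calc _ ≤ 3 / (d:ℝ) ^ 2 * (‖X‖ ^ 2 + 3 * n + 0) ^ 2 := by gcongr
    _ ≤ 3 / (d:ℝ) ^ 2 * (‖X‖ ^ 2 + 3 * (n + 1 : ℕ)) ^ 2 := by
      gcongr ?_ * ?_ ^ 2; push_cast; linarith
    _ = _ := by ring

include hn hinv in
lemma a2 (hd : 1 ≤ d) {n : ℕ} (i : Fin n) (X : EuclideanSpace ℝ (Fin d)) :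
    ∫ c, ⟪c i, X + ∑ j, c j - c i⟫_ℝ ^ 2 ∂(Measure.pi fun _ : Fin n => μ) ≤
      2 * ((‖X‖ ^ 2 + 3 * n) / d) := by
  have h1 := a4 hn hinv hd i X
  have h2 := jens (μ := μ) hn n (f := fun c => ⟪c i, X + ∑ j, c j - c i⟫_ℝ ^ 2) (by fun_prop)
  simp only [← pow_mul] at h2
  norm_num at h2
  refine le_of_sq_le_sq (h2.trans (h1.trans ?_)) (by positivity)
  nlinarith [sq_nonneg ((‖X‖ ^ 2 + 3 * n) / d)]

include hn hinv in
lemma cc2 (hd : 1 ≤ d) {n : ℕ} (i : Fin n) :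
    ∫ c, ∑ j, ⟪c i, c j⟫_ℝ ^ 2 ∂(Measure.pi fun _ : Fin n => μ) ≤ 1 + n / d := by
  obtain _ | n := n
  · exact i.elim0
  rw [pi_split hn i (by fun_prop)]
  have e : ∀ᵐ y ∂(Measure.pi fun _ : Fin n => μ),
      ∫ c, ∑ j, ⟪(i.insertNth (α := fun _ => EuclideanSpace ℝ (Fin d)) c y) i,
        (i.insertNth (α := fun _ => EuclideanSpace ℝ (Fin d)) c y) j⟫_ℝ ^ 2 ∂μ ≤
        1 + ((n + 1 : ℕ) : ℝ) / d := by
    filter_upwards [ae_pi_norm hn n] with y hy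
    have e1 : ∀ᵐ c ∂μ, ∑ j, ⟪(i.insertNth (α := fun _ => EuclideanSpace ℝ (Fin d)) c y) i,
        (i.insertNth (α := fun _ => EuclideanSpace ℝ (Fin d)) c y) j⟫_ℝ ^ 2 =
        1 + ∑ j, ⟪c, y j⟫_ℝ ^ 2 := by
      filter_upwards [hn] with c hc
      rw [Fin.sum_univ_succAbove _ i]
      simp [hc]
    rw [integral_congr_ae e1, integral_add (integrable_const _) (icont hn (by fun_prop)),
      integral_finsetSum _ (fun i _ => icont hn (by fun_prop))]
    simp_rw [s2 hn hinv hd, hy]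
    simp
    rw [← div_eq_mul_inv]
    gcongr; linarith
  refine (integral_mono_of_nonneg (ae_of_all _ fun y => integral_nonneg fun c => by positivity)
      (integrable_const _) e).trans (by simp)

end SpherePart

section FinalPart

/-- the explicit bound on the mean square error -/
noncomputable def totB (σ θ K D : ℝ) : ℝ :=
  5 * (σ ^ 4 * (2 * (1 / K + 1 / D)) + 3 * θ ^ 2 + 4 * (2 * θ) + 4 * σ ^ 2 * (3 * (1 / K))
    + 4 * σ ^ 2 * (2 * θ))

lemma condB_int {d k : ℕ} {μ : Measure (EuclideanSpace ℝ (Fin d))} [IsProbabilityMeasure μ]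
    (hn : ∀ᵐ c ∂μ, ‖c‖ = 1)
    (hinv : ∀ O : EuclideanSpace ℝ (Fin d) ≃ₗᵢ[ℝ] EuclideanSpace ℝ (Fin d), μ.map O = μ)
    (hd : 1 ≤ d) (hk : 0 < k) (σ : ℝ) (X : EuclideanSpace ℝ (Fin d)) :
    ∫ c, condB σ X c ∂(Measure.pi fun _ : Fin k => μ) ≤
      totB σ ((‖X‖ ^ 2 + 3 * k) / d) k d := by
  have hk' : (0 : ℝ) < k := by positivity
  have hd' : (0 : ℝ) < d := by positivity
  set P := Measure.pi fun _ : Fin k => μ with hP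
  set θ := (‖X‖ ^ 2 + 3 * (k:ℝ)) / d with hθ
  have avg : ∀ (f : Fin k → (Fin k → EuclideanSpace ℝ (Fin d)) → ℝ) (B : ℝ),
      (∀ i, Continuous (f i)) → (∀ i, ∫ c, f i c ∂P ≤ B) →
      (1 / k : ℝ) * ∫ c, ∑ i, f i c ∂P ≤ B := by
    intro f B hf hB
    rw [integral_finsetSum _ (fun i _ => icont_pi hn (hf i))]
    have : ∑ i, ∫ c, f i c ∂P ≤ ∑ _i : Fin k, B := Finset.sum_le_sum fun i _ => hB i
    simp at this
    rw [one_div, inv_mul_le_iff₀ hk']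
    exact this
  have b1 := avg (fun i c => ∑ j, ⟪c i, c j⟫_ℝ ^ 2) _ (fun i => by fun_prop)
    (fun i => cc2 hn hinv hd i)
  have b2 := avg (fun i c => ⟪c i, X + ∑ j, c j - c i⟫_ℝ ^ 4) _ (fun i => by fun_prop)
    (fun i => a4 hn hinv hd i X)
  have b3 := avg (fun i c => ⟪c i, X + ∑ j, c j - c i⟫_ℝ ^ 2) _ (fun i => by fun_prop)
    (fun i => a2 hn hinv hd i X)
  have b4 := norm2 (μ := μ) hn hinv k
  unfold condB
  rw [integral_const_mul, integral_add (icont_pi hn (by fun_prop)) (icont_pi hn (by fun_prop)),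
    integral_add (icont_pi hn (by fun_prop)) (icont_pi hn (by fun_prop)),
    integral_add (icont_pi hn (by fun_prop)) (icont_pi hn (by fun_prop)),
    integral_add (icont_pi hn (by fun_prop)) (icont_pi hn (by fun_prop))]
  simp_rw [integral_const_mul]
  unfold totB
  have c1 : 2 / (k:ℝ) ^ 2 * ∫ c, ∑ i, ∑ j, ⟪c i, c j⟫_ℝ ^ 2 ∂P ≤ 2 * (1 / k + 1 / d) := by
    calc _ = 2 / (k:ℝ) * ((1 / k : ℝ) * ∫ c, ∑ i, ∑ j, ⟪c i, c j⟫_ℝ ^ 2 ∂P) := by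
          field_simp
      _ ≤ 2 / (k:ℝ) * (1 + k / d) := by gcongr
      _ = _ := by field_simp
  have c4 : 1 / (k:ℝ) ^ 2 * ∫ c, ‖∑ j, c j‖ ^ 2 ∂P ≤ 3 * (1 / k) := by
    calc _ ≤ 1 / (k:ℝ) ^ 2 * (3 * k) := by gcongr
      _ = _ := by field_simp
  gcongr

lemma total_bound {d k : ℕ} {μ : Measure (EuclideanSpace ℝ (Fin d))} [IsProbabilityMeasure μ]
    (hn : ∀ᵐ c ∂μ, ‖c‖ = 1)
    (hinv : ∀ O : EuclideanSpace ℝ (Fin d) ≃ₗᵢ[ℝ] EuclideanSpace ℝ (Fin d), μ.map O = μ)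
    (hd : 1 ≤ d) (hk : 0 < k) (σ : ℝ) (X : EuclideanSpace ℝ (Fin d)) :
    ∫⁻ ω, ENNReal.ofReal (((1 / k : ℝ) * ∑ i, ⟪ω.1 i, rhoF d k X σ ω⟫_ℝ ^ 2
      - (1 + σ ^ 2)) ^ 2) ∂(canaryP d k μ) ≤
      ENNReal.ofReal (totB σ ((‖X‖ ^ 2 + 3 * k) / d) k d) := by
  unfold canaryP rhoF
  have hm : Continuous (fun ω : (Fin k → EuclideanSpace ℝ (Fin d)) × EuclideanSpace ℝ (Fin d) =>
      (((1 / k : ℝ) * ∑ i, ⟪ω.1 i, X + (∑ i, ω.1 i) + σ • ω.2⟫_ℝ ^ 2 - (1 + σ ^ 2)) ^ 2)) := by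
    fun_prop
  rw [lintegral_prod _ (hm.measurable.ennreal_ofReal).aemeasurable]
  have hcont : Continuous (fun c : Fin k → EuclideanSpace ℝ (Fin d) => condB σ X c) := by
    unfold condB; fun_prop
  have h0 : ∀ c : Fin k → EuclideanSpace ℝ (Fin d), 0 ≤ condB σ X c := fun c => by
    unfold condB; positivity
  calc _ ≤ ∫⁻ c, ENNReal.ofReal (condB σ X c) ∂(Measure.pi fun _ : Fin k => μ) := by
        refine lintegral_mono_ae ?_
        filter_upwards [ae_pi_norm hn k] with c hc
        exact inner_bound hk σ X c hc
    _ = ENNReal.ofReal (∫ c, condB σ X c ∂(Measure.pi fun _ : Fin k => μ)) :=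
        (ofReal_integral_eq_lintegral_ofReal (icont_pi hn hcont) (ae_of_all _ h0)).symm
    _ ≤ _ := ENNReal.ofReal_le_ofReal (condB_int hn hinv hd hk σ X)

end FinalPart

/-- Under the asymptotic one-shot random-canary setup, the average
squared canary–output inner product `(1/k) ∑ᵢ ⟪c_{di}, ρ_d⟫²` converges in probability
to `1 + σ²` as `d → ∞`; in particular its variance tends to `0`. -/
theorem avg_sq_canary_inner_tendsto_in_probability
    (X : ∀ d : ℕ, EuclideanSpace ℝ (Fin d))
    (hX : (fun d : ℕ => ‖X d‖) =o[atTop] fun d : ℕ => Real.sqrt d)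
    (k : ℕ → ℕ)
    (hk₁ : Tendsto (fun d : ℕ => (k d : ℝ)) atTop atTop)
    (hk₂ : Tendsto (fun d : ℕ => (k d : ℝ) / d) atTop (𝓝 0))
    (σ : ℝ) (hσ : 0 < σ)
    (μs : ∀ d : ℕ, Measure (EuclideanSpace ℝ (Fin d)))
    (hprob : ∀ d, 1 ≤ d → IsProbabilityMeasure (μs d))
    (hsphere : ∀ d, 1 ≤ d → μs d (Metric.sphere (0 : EuclideanSpace ℝ (Fin d)) 1) = 1)
    (hinv : ∀ d, 1 ≤ d →
      ∀ O : EuclideanSpace ℝ (Fin d) ≃ₗᵢ[ℝ] EuclideanSpace ℝ (Fin d),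
        (μs d).map O = μs d)
    :
    (∀ ε : ℝ, 0 < ε →
      Tendsto (fun d : ℕ =>
          canaryP d (k d) (μs d)
            {ω | ε ≤ |(1 / (k d) : ℝ) *
              (∑ i, ⟪ω.1 i, rhoF d (k d) (X d) σ ω⟫_ℝ ^ 2) - (1 + σ ^ 2)|})
        atTop (𝓝 0)) ∧
      Tendsto (fun d : ℕ =>
          variance
            (fun ω => (1 / (k d) : ℝ) * ∑ i, ⟪ω.1 i, rhoF d (k d) (X d) σ ω⟫_ℝ ^ 2)
            (canaryP d (k d) (μs d)))
        atTop (𝓝 0) := by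
  set B : ℕ → ℝ := fun d => totB σ ((‖X d‖ ^ 2 + 3 * (k d : ℝ)) / d) (k d) d with hB
  have hBt : Tendsto B atTop (𝓝 0) := by
    have hx : Tendsto (fun d : ℕ => ‖X d‖ ^ 2 / d) atTop (𝓝 0) := by
      have h1 := hX.tendsto_div_nhds_zero.pow 2
      simp only [div_pow, ne_eq, OfNat.ofNat_ne_zero, not_false_eq_true, zero_pow] at h1
      refine h1.congr fun d => ?_
      rw [Real.sq_sqrt (Nat.cast_nonneg d)]
    have hθ : Tendsto (fun d : ℕ => (‖X d‖ ^ 2 + 3 * (k d : ℝ)) / d) atTop (𝓝 0) := by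
      have := hx.add (hk₂.const_mul 3)
      simp only [mul_zero, add_zero] at this
      refine this.congr fun d => ?_
      ring
    have hK : Tendsto (fun d : ℕ => 1 / (k d : ℝ)) atTop (𝓝 0) := by
      simp only [one_div]; exact hk₁.inv_tendsto_atTop
    have hD : Tendsto (fun d : ℕ => 1 / (d : ℝ)) atTop (𝓝 0) :=
      tendsto_one_div_atTop_nhds_zero_nat
    have := ((((((hK.add hD).const_mul 2).const_mul (σ ^ 4)).add ((hθ.pow 2).const_mul 3)).add
      ((hθ.const_mul 2).const_mul 4)).add ((hK.const_mul 3).const_mul (4 * σ ^ 2))).add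
      ((hθ.const_mul 2).const_mul (4 * σ ^ 2))
    have := this.const_mul 5
    simpa [hB, totB] using this
  have hev : ∀ᶠ d : ℕ in atTop, 1 ≤ d ∧ 0 < k d := by
    filter_upwards [eventually_ge_atTop 1, hk₁.eventually_gt_atTop 0] with d h1 h2
    exact ⟨h1, by exact_mod_cast h2⟩
  have hBt' : Tendsto (fun d => ENNReal.ofReal (B d)) atTop (𝓝 0) := by
    simpa using ENNReal.tendsto_ofReal hBt
  have hcont : ∀ d, Continuous
      (fun ω : (Fin (k d) → EuclideanSpace ℝ (Fin d)) × EuclideanSpace ℝ (Fin d) =>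
      (1 / (k d) : ℝ) * (∑ i, ⟪ω.1 i, rhoF d (k d) (X d) σ ω⟫_ℝ ^ 2)) := by
    intro d; unfold rhoF; fun_prop
  refine ⟨fun ε hε => ?_, ?_⟩
  · have hlim : Tendsto (fun d => ENNReal.ofReal (B d) / ENNReal.ofReal (ε ^ 2)) atTop (𝓝 0) := by
      have := ENNReal.Tendsto.div_const hBt' (b := ENNReal.ofReal (ε ^ 2))
        (Or.inr (by simp [hε.ne', hε]))
      simpa using this
    refine tendsto_of_tendsto_of_tendsto_of_le_of_le' tendsto_const_nhds hlim
      (Eventually.of_forall fun _ => zero_le) ?_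
    filter_upwards [hev] with d ⟨hd, hk⟩
    haveI := hprob d hd
    have hT := total_bound (ae_norm (hsphere d hd)) (hinv d hd) hd hk σ (X d)
    have hm := meas_ge_le_lintegral_div (μ := canaryP d (k d) (μs d))
      (((((hcont d).sub continuous_const).pow 2).measurable.ennreal_ofReal).aemeasurable
        (f := fun ω => ENNReal.ofReal (((1 / (k d) : ℝ) *
          (∑ i, ⟪ω.1 i, rhoF d (k d) (X d) σ ω⟫_ℝ ^ 2) - (1 + σ ^ 2)) ^ 2)))
      (ε := ENNReal.ofReal (ε ^ 2)) (by simp [hε.ne', hε]) ENNReal.ofReal_ne_top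
    refine (measure_mono ?_).trans (hm.trans (ENNReal.div_le_div_right hT _))
    intro ω hω
    simp only [Set.mem_ofPred_eq] at hω ⊢
    refine ENNReal.ofReal_le_ofReal ?_
    rw [← sq_abs (_ - _)]
    gcongr
  · refine tendsto_of_tendsto_of_tendsto_of_le_of_le' tendsto_const_nhds hBt
      (Eventually.of_forall fun _ => variance_nonneg _ _) ?_
    filter_upwards [hev] with d ⟨hd, hk⟩
    haveI := hprob d hd
    haveI : IsProbabilityMeasure (canaryP d (k d) (μs d)) := by
      unfold canaryP; infer_instance
    have hT := total_bound (ae_norm (hsphere d hd)) (hinv d hd) hd hk σ (X d)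
    have hB0 : 0 ≤ B d := by
      simp only [hB, totB]; positivity
    rw [← variance_sub_const (hcont d).aestronglyMeasurable (1 + σ ^ 2)]
    refine (variance_le_expectation_sq
      ((hcont d).sub continuous_const).aestronglyMeasurable).trans ?_
    rw [integral_eq_lintegral_of_nonneg_ae (ae_of_all _ fun ω => by simp; positivity)
      (((hcont d).sub continuous_const).pow 2).aestronglyMeasurable]
    exact ENNReal.toReal_le_of_le_ofReal hB0 hT
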